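/- Let Q be a finite directed graph admitting a coloring c : V → ℤ/3ℤ and with all mixed-walk directed distances (forward cost 1, backward cost 2) finite. Suppose u → w, w → x, x → u are arrows of Q forming a directed triangle. Then for every vertex v there exists a natural number d such that the multiset of the three values δ(u,v), δ(w,v), δ(x,v) equals {d, d+1, d+2}. -/

import Mathlib

/-- `MixedWalk k A v w ℓ` : there is a mixed walk from `v` to `w` of total cost `ℓ`,
where each step traverses an arrow of `A` either forwards at cost `1` or backwards at
cost `k - 1` (so cost `2` when `k = 3`). -/
inductive MixedWalk {V : Type*} (k : ℕ) (A : V → V → Prop) : V → V → ℕ → Prop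
  | nil (v : V) : MixedWalk k A v v 0
  | fwd {v w x : V} {ℓ : ℕ} : A v w → MixedWalk k A w x ℓ → MixedWalk k A v x (ℓ + 1)
  | bwd {v w x : V} {ℓ : ℕ} : A w v → MixedWalk k A w x ℓ → MixedWalk k A v x (ℓ + (k - 1))

/-- A coloring of a directed graph: `c(w) = c(v) + 1` along every arrow `v → w`. -/
def IsColoring {V : Type*} (k : ℕ) (A : V → V → Prop) (c : V → ZMod k) : Prop :=
  ∀ v w : V, A v w → c w = c v + 1

theorem mixedWalk_color {V : Type} (A : V → V → Prop)
    (c : V → ZMod 3) (hc : IsColoring 3 A c) {a b : V} {l : ℕ} (h : MixedWalk 3 A a b l) :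
    (l : ZMod 3) = c b - c a := by
  induction h with
  | nil v => simp
  | fwd hA _ ih => rw [Nat.cast_add, ih, hc _ _ hA]; push_cast; ring
  | bwd hA _ ih =>
    rw [Nat.cast_add, ih, hc _ _ hA]
    have h3 : ((3 - 1 : ℕ) : ZMod 3) = -1 := by decide
    rw [h3]; ring

theorem mixedWalk_step {V : Type} (A : V → V → Prop)
    (c : V → ZMod 3) (hc : IsColoring 3 A c)
    (δ : V → V → ℕ)
    (hδ : ∀ v w : V, IsLeast {ℓ : ℕ | MixedWalk 3 A v w ℓ} (δ v w))
    (a b v : V) (hab : A a b) : δ a v = δ b v + 1 ∨ δ a v + 2 = δ b v := by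
  have h1 : δ a v ≤ δ b v + 1 := (hδ a v).2 (MixedWalk.fwd hab (hδ b v).1)
  have h2 : δ b v ≤ δ a v + 2 := (hδ b v).2 (MixedWalk.bwd hab (hδ a v).1)
  have h3 : ((δ a v : ℕ) : ZMod 3) = ((δ b v + 1 : ℕ) : ZMod 3) := by
    push_cast
    rw [mixedWalk_color A c hc (hδ a v).1, mixedWalk_color A c hc (hδ b v).1, hc _ _ hab]
    ring
  rw [ZMod.natCast_eq_natCast_iff'] at h3
  omega

/-- In a finite directed graph with a `ℤ/3ℤ`-coloring and all mixed-walk directed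
distances finite, if `u → w → x → u` is a directed triangle, then for every vertex `v`
the three distances `δ(u,v), δ(w,v), δ(x,v)` are, as a multiset, `{d, d+1, d+2}`
for some `d`. -/
theorem stmt_5 {V : Type} [Fintype V] (A : V → V → Prop)
    (c : V → ZMod 3) (hc : IsColoring 3 A c)
    (δ : V → V → ℕ)
    (hδ : ∀ v w : V, IsLeast {ℓ : ℕ | MixedWalk 3 A v w ℓ} (δ v w))
    (u w x : V) (huw : A u w) (hwx : A w x) (hxu : A x u) :
    ∀ v : V, ∃ d : ℕ,
      ({δ u v, δ w v, δ x v} : Multiset ℕ) = ({d, d + 1, d + 2} : Multiset ℕ) := by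
  intro v
  have h1 := mixedWalk_step A c hc δ hδ u w v huw
  have h2 := mixedWalk_step A c hc δ hδ w x v hwx
  have h3 := mixedWalk_step A c hc δ hδ x u v hxu
  generalize δ u v = p at *
  generalize δ w v = q at *
  generalize δ x v = r at *
  have h : (p = r + 2 ∧ q = r + 1) ∨ (q = p + 2 ∧ r = p + 1) ∨ (r = q + 2 ∧ p = q + 1) := by
    omega
  rcases h with ⟨rfl, rfl⟩ | ⟨rfl, rfl⟩ | ⟨rfl, rfl⟩
  · refine ⟨r, ?_⟩
    ext a
    simp only [Multiset.insert_eq_cons, Multiset.count_cons, Multiset.count_singleton]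
    omega
  · refine ⟨p, ?_⟩
    ext a
    simp only [Multiset.insert_eq_cons, Multiset.count_cons, Multiset.count_singleton]
    omega
  · refine ⟨q, ?_⟩
    ext a
    simp only [Multiset.insert_eq_cons, Multiset.count_cons, Multiset.count_singleton]
    omega
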